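/- arXiv:1711.11215 — 2 statements merged into one kernel-verified Lean document; each statement's English description precedes it below -/
import Mathlib

section
/- Fix a positive integer ℓ and define S_ℓ : (0, ∞) → ℝ by S_ℓ(α) = (α + ℓ²/α)·Q(ℓ/α) − (ℓ/√(2π))·e^{−ℓ²/(2α²)}. Then S_ℓ is strictly convex on (0, ∞). -/
open Real

/-- The standard normal tail function `Q(x) = ∫_x^∞ (2π)^{-1/2} e^{-t²/2} dt`. -/
noncomputable def Qfun (x : ℝ) : ℝ :=
  ∫ t in Set.Ioi x, (Real.sqrt (2 * Real.pi))⁻¹ * Real.exp (-t ^ 2 / 2)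

/-- The function `S_ℓ` from Lemma 3 of the paper. -/
noncomputable def Sfun (ℓ : ℕ) (α : ℝ) : ℝ :=
  (α + (ℓ : ℝ) ^ 2 / α) * Qfun ((ℓ : ℝ) / α)
    - ((ℓ : ℝ) / Real.sqrt (2 * Real.pi)) * Real.exp (-(ℓ : ℝ) ^ 2 / (2 * α ^ 2))

lemma integrable_gaussian_density :
    MeasureTheory.Integrable
      (fun t : ℝ => (Real.sqrt (2 * Real.pi))⁻¹ * Real.exp (-t ^ 2 / 2)) := by
  refine MeasureTheory.Integrable.const_mul ?_ _
  refine (integrable_exp_neg_mul_sq (b := 1 / 2) (by norm_num)).congr (.of_forall fun t => ?_)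
  ring_nf

lemma hasDerivAt_Qfun (x : ℝ) :
    HasDerivAt Qfun (-((Real.sqrt (2 * Real.pi))⁻¹ * Real.exp (-x ^ 2 / 2))) x := by
  have hQ : Qfun = fun y => Qfun 0 -
      ∫ t in (0 : ℝ)..y, (Real.sqrt (2 * Real.pi))⁻¹ * Real.exp (-t ^ 2 / 2) := by
    funext y
    rw [← intervalIntegral.integral_Ioi_sub_Ioi'
      integrable_gaussian_density.integrableOn integrable_gaussian_density.integrableOn]
    simp [Qfun]
  rw [hQ]
  have hc : Continuous
      (fun t : ℝ => (Real.sqrt (2 * Real.pi))⁻¹ * Real.exp (-t ^ 2 / 2)) := by fun_prop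
  exact (hc.integral_hasStrictDerivAt 0 x).hasDerivAt.const_sub _

lemma Qfun_pos (x : ℝ) : 0 < Qfun x := by
  have hpos (t : ℝ) : 0 < (Real.sqrt (2 * Real.pi))⁻¹ * Real.exp (-t ^ 2 / 2) := by positivity
  have hsupp : Function.support
      (fun t : ℝ => (Real.sqrt (2 * Real.pi))⁻¹ * Real.exp (-t ^ 2 / 2)) = Set.univ :=
    Set.eq_univ_of_forall fun t => (hpos t).ne'
  rw [Qfun, MeasureTheory.setIntegral_pos_iff_support_of_nonneg_ae
    (.of_forall fun t => (hpos t).le) integrable_gaussian_density.integrableOn, hsupp]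
  simp

lemma hasDerivAt_Sfun (ℓ : ℕ) {α : ℝ} (hα : 0 < α) :
    HasDerivAt (Sfun ℓ) ((1 - ((ℓ : ℝ) / α) ^ 2) * Qfun ((ℓ : ℝ) / α)
      + (ℓ : ℝ) / α * ((Real.sqrt (2 * Real.pi))⁻¹ * Real.exp (-((ℓ : ℝ) / α) ^ 2 / 2))) α := by
  have hne := hα.ne'
  have hdiv (c : ℝ) : HasDerivAt (fun a : ℝ => c / a) (-c / α ^ 2) α := by
    simpa [div_eq_mul_inv] using (hasDerivAt_inv hne).const_mul c
  have hQ := (hasDerivAt_Qfun ((ℓ : ℝ) / α)).comp α (hdiv ℓ)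
  have hexp : HasDerivAt (fun a : ℝ => Real.exp (-(ℓ : ℝ) ^ 2 / (2 * a ^ 2)))
      (Real.exp (-((ℓ : ℝ) / α) ^ 2 / 2) * ((ℓ : ℝ) ^ 2 / α ^ 3)) α := by
    have h := ((hasDerivAt_const α (-(ℓ : ℝ) ^ 2)).div
      (((hasDerivAt_id α).pow 2).const_mul 2) (by simpa using hne)).exp
    refine h.congr_deriv ?_
    simp only [Pi.div_apply, Pi.pow_apply, id]
    have harg : -(ℓ : ℝ) ^ 2 / (2 * α ^ 2) = -((ℓ : ℝ) / α) ^ 2 / 2 := by field_simp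
    rw [harg]
    congr 1
    field_simp
    ring
  have h := (((hasDerivAt_id α).add (hdiv ((ℓ : ℝ) ^ 2))).mul hQ).sub
    (hexp.const_mul ((ℓ : ℝ) / Real.sqrt (2 * Real.pi)))
  refine h.congr_deriv ?_
  have hs : Real.sqrt (2 * Real.pi) ≠ 0 := by positivity
  simp only [Pi.add_apply, Function.comp_apply, id]
  generalize Real.exp (-((ℓ : ℝ) / α) ^ 2 / 2) = E
  generalize Qfun ((ℓ : ℝ) / α) = q
  field_simp
  ring

lemma strictAntiOn_one_sub_sq_mul_Qfun_add :
    StrictAntiOn (fun x : ℝ => (1 - x ^ 2) * Qfun x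
      + x * ((Real.sqrt (2 * Real.pi))⁻¹ * Real.exp (-x ^ 2 / 2))) (Set.Ici 0) := by
  have hderiv (x : ℝ) : HasDerivAt (fun x : ℝ => (1 - x ^ 2) * Qfun x
      + x * ((Real.sqrt (2 * Real.pi))⁻¹ * Real.exp (-x ^ 2 / 2))) (-(2 * x * Qfun x)) x := by
    have hexp := ((((hasDerivAt_id x).pow 2).neg.div_const 2).exp).const_mul
      (Real.sqrt (2 * Real.pi))⁻¹
    have h := ((((hasDerivAt_id x).pow 2).const_sub 1).mul (hasDerivAt_Qfun x)).add
      ((hasDerivAt_id x).mul hexp)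
    refine h.congr_deriv ?_
    simp
    ring
  refine strictAntiOn_of_deriv_neg (convex_Ici 0)
    (fun x _ => (hderiv x).continuousAt.continuousWithinAt) fun x hx => ?_
  rw [interior_Ici] at hx
  rw [(hderiv x).deriv]
  have hx0 : 0 < x := hx
  have := Qfun_pos x
  exact neg_neg_of_pos (by positivity)

theorem stmt9 (ℓ : ℕ) (hℓ : 0 < ℓ) :
    StrictConvexOn ℝ (Set.Ioi (0 : ℝ)) (Sfun ℓ) := by
  refine StrictMonoOn.strictConvexOn_of_deriv (convex_Ioi 0)
    (fun α hα => (hasDerivAt_Sfun ℓ hα).continuousAt.continuousWithinAt) ?_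
  rw [interior_Ioi]
  intro a ha b hb hab
  have ha0 : 0 < a := ha
  have hb0 : 0 < b := hb
  rw [(hasDerivAt_Sfun ℓ ha).deriv, (hasDerivAt_Sfun ℓ hb).deriv]
  have hℓ' : (0 : ℝ) < ℓ := by exact_mod_cast hℓ
  exact strictAntiOn_one_sub_sq_mul_Qfun_add (Set.mem_Ici.2 (by positivity))
    (Set.mem_Ici.2 (by positivity)) (div_lt_div_of_pos_left hℓ' ha0 hab)
end

section
/- Fix δ ∈ (1/2, ∞) and SNR > 0, and let τ* be the unique positive minimizer of F. Then √((δ − 1/2)·SNR) ≤ 1/τ* < √(δ·SNR). -/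
open Real

/-- The function `F` from the paper, with parameters `δ` and `SNR`. -/
noncomputable def Ffun (δ SNR τ : ℝ) : ℝ :=
  τ * (δ - 1 / 2) + (1 / SNR) / τ + (τ + 4 / τ) * Qfun (2 / τ)
    - Real.sqrt (2 / Real.pi) * Real.exp (-2 / τ ^ 2)

/-- The standard normal density. -/
noncomputable def normalDensity (t : ℝ) : ℝ :=
  (Real.sqrt (2 * Real.pi))⁻¹ * Real.exp (-t ^ 2 / 2)

lemma normalDensity_pos (t : ℝ) : 0 < normalDensity t := by
  unfold normalDensity; positivity

lemma hasDerivAt_normalDensity (t : ℝ) :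
    HasDerivAt normalDensity (-(t * normalDensity t)) t := by
  have h : HasDerivAt (fun t : ℝ => -t ^ 2 / 2) (-t) t := by
    refine (((hasDerivAt_id t).pow 2).neg.div_const 2).congr_deriv ?_
    simp
    ring
  refine (h.exp.const_mul _).congr_deriv ?_
  unfold normalDensity
  ring

lemma continuous_normalDensity : Continuous normalDensity :=
  continuous_iff_continuousAt.2 fun t => (hasDerivAt_normalDensity t).continuousAt

lemma integrable_normalDensity : MeasureTheory.Integrable normalDensity := by
  refine ((integrable_exp_neg_mul_sq (b := 1 / 2) (by norm_num)).const_mul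
    (Real.sqrt (2 * Real.pi))⁻¹).congr (.of_forall fun t => ?_)
  simp only [normalDensity]
  ring_nf

lemma integrable_mul_normalDensity :
    MeasureTheory.Integrable fun t => t * normalDensity t := by
  refine ((integrable_mul_exp_neg_mul_sq (b := 1 / 2) (by norm_num)).const_mul
    (Real.sqrt (2 * Real.pi))⁻¹).congr (.of_forall fun t => ?_)
  simp only [normalDensity]
  ring_nf

lemma tendsto_normalDensity_atTop :
    Filter.Tendsto normalDensity Filter.atTop (nhds 0) := by
  have h : Filter.Tendsto (fun t : ℝ => -t ^ 2 / 2) Filter.atTop Filter.atBot := by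
    have h2 : Filter.Tendsto (fun t : ℝ => t ^ 2 / 2) Filter.atTop Filter.atTop :=
      (Filter.tendsto_pow_atTop two_ne_zero).atTop_div_const two_pos
    simpa only [neg_div, Function.comp_def] using Filter.tendsto_neg_atTop_atBot.comp h2
  rw [← mul_zero (Real.sqrt (2 * Real.pi))⁻¹]
  exact (Real.tendsto_exp_atBot.comp h).const_mul _

lemma Qfun_eq (x : ℝ) : Qfun x = ∫ t in Set.Ioi x, normalDensity t := rfl

lemma Qfun_zero : Qfun 0 = 1 / 2 := by
  have h : ∫ t in Set.Ioi (0 : ℝ), Real.exp (-t ^ 2 / 2) = Real.sqrt (2 * Real.pi) / 2 := by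
    rw [show 2 * Real.pi = Real.pi / (1 / 2) by ring, ← integral_gaussian_Ioi]
    congr 1
    ext t
    ring_nf
  rw [Qfun, MeasureTheory.integral_const_mul, h]
  have : Real.sqrt (2 * Real.pi) ≠ 0 := by positivity
  field_simp

lemma hasDerivAt_Qfun_s12 (x : ℝ) : HasDerivAt Qfun (-normalDensity x) x := by
  have h : Qfun = fun y => Qfun 0 - ∫ t in (0 : ℝ)..y, normalDensity t := by
    ext y
    have := intervalIntegral.integral_interval_add_Ioi (a := 0) (b := y)
      integrable_normalDensity.integrableOn integrable_normalDensity.integrableOn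
    rw [Qfun_eq, Qfun_eq]
    linarith
  rw [h]
  exact (continuous_normalDensity.integral_hasStrictDerivAt 0 x).hasDerivAt.const_sub _

lemma mul_Qfun_le_normalDensity (x : ℝ) : x * Qfun x ≤ normalDensity x := by
  have h : ∫ t in Set.Ioi x, -(t * normalDensity t) = 0 - normalDensity x :=
    MeasureTheory.integral_Ioi_of_hasDerivAt_of_tendsto'
      (fun t _ => hasDerivAt_normalDensity t)
      integrable_mul_normalDensity.neg.integrableOn tendsto_normalDensity_atTop
  rw [MeasureTheory.integral_neg] at h
  have h2 : ∫ t in Set.Ioi x, x * normalDensity t ≤ ∫ t in Set.Ioi x, t * normalDensity t :=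
    MeasureTheory.setIntegral_mono_on (integrable_normalDensity.const_mul x).integrableOn
      integrable_mul_normalDensity.integrableOn measurableSet_Ioi
      fun t ht => mul_le_mul_of_nonneg_right (Set.mem_Ioi.1 ht).le (normalDensity_pos t).le
  rw [MeasureTheory.integral_const_mul, ← Qfun_eq] at h2
  linarith

/-- The truncated moment `∫ t in Ioi x, (t ^ 2 - x ^ 2) * normalDensity t` in closed form. -/
noncomputable def tailMoment (x : ℝ) : ℝ :=
  (1 - x ^ 2) * Qfun x + x * normalDensity x

lemma tailMoment_pos {x : ℝ} (hx : 0 ≤ x) : 0 < tailMoment x := by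
  have h := mul_le_mul_of_nonneg_left (mul_Qfun_le_normalDensity x) hx
  have := Qfun_pos x
  unfold tailMoment
  nlinarith

lemma hasDerivAt_tailMoment (x : ℝ) : HasDerivAt tailMoment (-(2 * x * Qfun x)) x := by
  refine (((((hasDerivAt_id x).pow 2).const_sub 1).mul (hasDerivAt_Qfun_s12 x)).add
    ((hasDerivAt_id x).mul (hasDerivAt_normalDensity x))).congr_deriv ?_
  simp
  ring

lemma tailMoment_lt_half {x : ℝ} (hx : 0 < x) : tailMoment x < 1 / 2 := by
  have h : StrictAntiOn tailMoment (Set.Ici 0) := by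
    refine strictAntiOn_of_deriv_neg (convex_Ici 0)
      (fun y _ => (hasDerivAt_tailMoment y).continuousAt.continuousWithinAt) fun y hy => ?_
    rw [interior_Ici, Set.mem_Ioi] at hy
    have := Qfun_pos y
    rw [(hasDerivAt_tailMoment y).deriv, neg_lt_zero]
    positivity
  have h0 : tailMoment 0 = 1 / 2 := by simp [tailMoment, Qfun_zero]
  exact h0 ▸ h Set.self_mem_Ici hx.le hx

lemma Ffun_eq (δ SNR τ : ℝ) :
    Ffun δ SNR τ = τ * (δ - 1 / 2) + (1 / SNR) * τ⁻¹ + (τ + 4 * τ⁻¹) * Qfun (2 * τ⁻¹)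
      - 2 * normalDensity (2 * τ⁻¹) := by
  have hs : Real.sqrt (2 / Real.pi) = 2 * (Real.sqrt (2 * Real.pi))⁻¹ := by
    rw [show 2 / Real.pi = 2 ^ 2 / (2 * Real.pi) by field_simp,
      Real.sqrt_div (by norm_num), Real.sqrt_sq (by norm_num), div_eq_mul_inv]
  have he : -2 / τ ^ 2 = -(2 * τ⁻¹) ^ 2 / 2 := by ring
  rw [Ffun, hs, he, normalDensity]
  simp only [div_eq_mul_inv]
  ring

lemma hasDerivAt_Ffun (δ SNR : ℝ) {τ : ℝ} (hτ : τ ≠ 0) :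
    HasDerivAt (Ffun δ SNR)
      (δ - 1 / 2 - 1 / SNR * (1 / τ) ^ 2 + tailMoment (2 * τ⁻¹)) τ := by
  have hi := hasDerivAt_inv hτ
  have hx := hi.const_mul 2
  rw [funext (Ffun_eq δ SNR)]
  refine (((((hasDerivAt_id τ).mul_const (δ - 1 / 2)).add (hi.const_mul (1 / SNR))).add
    (((hasDerivAt_id τ).add (hi.const_mul 4)).mul
      ((hasDerivAt_Qfun_s12 _).comp τ hx))).sub
    (((hasDerivAt_normalDensity _).comp τ hx).const_mul 2)).congr_deriv ?_
  simp only [tailMoment, id, Function.comp, Pi.add_apply]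
  field_simp
  ring

theorem stmt12 (δ SNR : ℝ) (hδ : 1 / 2 < δ) (hSNR : 0 < SNR)
    (τs : ℝ) (hτs : 0 < τs)
    (hmin : ∀ τ : ℝ, 0 < τ → Ffun δ SNR τs ≤ Ffun δ SNR τ) :
    Real.sqrt ((δ - 1 / 2) * SNR) ≤ 1 / τs ∧ 1 / τs < Real.sqrt (δ * SNR) := by
  have hloc : IsLocalMin (Ffun δ SNR) τs := by
    filter_upwards [lt_mem_nhds hτs] with τ hτ using hmin τ hτ
  have hcrit := hloc.hasDerivAt_eq_zero (hasDerivAt_Ffun δ SNR hτs.ne')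
  have hx : 0 < 2 * τs⁻¹ := by positivity
  have hpos := tailMoment_pos hx.le
  have hlt := tailMoment_lt_half hx
  have heq : (1 / τs) ^ 2 = (δ - 1 / 2 + tailMoment (2 * τs⁻¹)) * SNR := by
    have : 1 / SNR * (1 / τs) ^ 2 = δ - 1 / 2 + tailMoment (2 * τs⁻¹) := by linarith
    rw [← this]
    field_simp
  refine ⟨Real.sqrt_le_iff.2 ⟨by positivity, ?_⟩, Real.lt_sqrt_of_sq_lt ?_⟩
  · rw [heq]
    gcongr
    linarith
  · rw [heq]
    gcongr
    linarith
end
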